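/- Existence of a deterministic stationary policy achieving the optimal average reward: Let (S, A, P) be a finite MDP, let s₁ ∈ S be any initial state, and let r : S × A → ℝ be any (bounded) reward function. Then there exists a deterministic stationary policy π* ∈ Π whose occupation measure q* from s₁ exists (the defining Cesàro limits converge) and satisfies r·q* = sup { r·q : q ∈ Q(s₁) }. -/

import Mathlib

open Finset Filter Topology

noncomputable section

/-- `P` is a transition kernel: nonnegative and each row sums to one. -/
def IsKernel {S A : Type*} [Fintype S] (P : S → A → S → ℝ) : Prop :=
  (∀ s a s', 0 ≤ P s a s') ∧ ∀ s a, ∑ s', P s a s' = 1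

/-- `π` is a stationary randomized policy. -/
def IsPolicy {S A : Type*} [Fintype A] (π : S → A → ℝ) : Prop :=
  (∀ s a, 0 ≤ π s a) ∧ ∀ s, ∑ a, π s a = 1

/-- The Markov matrix induced by policy `π` on kernel `P`. -/
def markovMatrix {S A : Type*} [Fintype A] (P : S → A → S → ℝ) (π : S → A → ℝ) :
    Matrix S S ℝ :=
  fun s s' => ∑ a, π s a * P s a s'

/-- `C` is closed under the Markov matrix `M`. -/
def IsClosedClass {S : Type*} (M : Matrix S S ℝ) (C : Set S) : Prop :=
  ∀ s ∈ C, ∀ s' ∉ C, M s s' = 0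

/-- `C` is irreducible under the Markov matrix `M`. -/
def IsIrreducibleOn {S : Type*} [Fintype S] [DecidableEq S] (M : Matrix S S ℝ)
    (C : Set S) : Prop :=
  ∀ s ∈ C, ∀ s' ∈ C, ∃ n : ℕ, 0 < (M ^ n) s s'

/-- `s` is a transient state under the Markov matrix `M`. -/
def IsTransient {S : Type*} [Fintype S] [DecidableEq S] (M : Matrix S S ℝ) (s : S) : Prop :=
  Summable fun n : ℕ => (M ^ (n + 1)) s s

/-- The MDP `(S, A, P)` is weakly communicating. -/
def WeaklyCommunicating {S A : Type*} [Fintype S] [DecidableEq S] [Fintype A]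
    (P : S → A → S → ℝ) : Prop :=
  ∃ (π : S → A → ℝ) (C : Set S), IsPolicy π ∧ C.Nonempty ∧
    IsClosedClass (markovMatrix P π) C ∧ IsIrreducibleOn (markovMatrix P π) C ∧
    ∀ s ∉ C, ∀ π' : S → A → ℝ, IsPolicy π' → IsTransient (markovMatrix P π') s

/-- `q` is the occupation measure of the policy `π` from initial state `s₁`:
the Cesàro averages `(1/T) ∑_{t=1}^T (P_π^{t-1})(s₁,s) ⬝ π s a` converge to `q (s,a)`. -/
def IsOccupation {S A : Type*} [Fintype S] [DecidableEq S] [Fintype A]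
    (P : S → A → S → ℝ) (π : S → A → ℝ) (s₁ : S) (q : S × A → ℝ) : Prop :=
  ∀ s a, Tendsto
    (fun T : ℕ => (1 / (T : ℝ)) * ∑ t ∈ Finset.range T, ((markovMatrix P π) ^ t) s₁ s * π s a)
    atTop (𝓝 (q (s, a)))

/-- `Q(s₁)`: the set of occupation measures of stationary policies from `s₁`. -/
def occSet {S A : Type*} [Fintype S] [DecidableEq S] [Fintype A]
    (P : S → A → S → ℝ) (s₁ : S) : Set (S × A → ℝ) :=
  {q | ∃ π : S → A → ℝ, IsPolicy π ∧ IsOccupation P π s₁ q}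

/-- `c·q = ∑_{(s,a)} c(s,a) q(s,a)`. -/
def dotSA {S A : Type*} [Fintype S] [Fintype A] (c q : S × A → ℝ) : ℝ :=
  ∑ p, c p * q p

/-- The dual function `D(λ) = sup { r·q + λ(g·q − b) : q ∈ Q(s₁) }`. -/
def dualFn {S A : Type*} [Fintype S] [DecidableEq S] [Fintype A]
    (P : S → A → S → ℝ) (s₁ : S) (r g : S × A → ℝ) (b : ℝ) (lam : ℝ) : ℝ :=
  sSup {x | ∃ q ∈ occSet P s₁, x = dotSA r q + lam * (dotSA g q - b)}

/-- The flow polytope `𝓟`. -/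
def flowPolytope {S A : Type*} [Fintype S] [Fintype A] (P : S → A → S → ℝ) :
    Set (S × A → ℝ) :=
  {q | (∀ p, 0 ≤ q p) ∧ (∑ p, q p = 1) ∧
    ∀ s, ∑ a, q (s, a) = ∑ p : S × A, P p.1 p.2 s * q p}

/-- A nonnegative matrix with unit row sums has entries in the unit interval. -/
lemma Matrix.mem_Icc_of_mem_rowStochastic {S : Type*} [Fintype S] [DecidableEq S]
    {M : Matrix S S ℝ} (hM : M ∈ Matrix.rowStochastic ℝ S) (i j : S) :
    M i j ∈ Set.Icc (0 : ℝ) 1 :=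
  ⟨Matrix.nonneg_of_mem_rowStochastic hM, Matrix.le_one_of_mem_rowStochastic hM⟩

/-- The Cesàro averages of the powers of a matrix. -/
def cesaroPow {S : Type*} [Fintype S] [DecidableEq S] (M : Matrix S S ℝ) (T : ℕ) :
    Matrix S S ℝ :=
  (1 / (T : ℝ)) • ∑ t ∈ Finset.range T, M ^ t

section Cesaro

variable {S : Type*} [Fintype S] [DecidableEq S] {M : Matrix S S ℝ}

lemma cesaroPow_apply (T : ℕ) (i j : S) :
    cesaroPow M T i j = (1 / (T : ℝ)) * ∑ t ∈ Finset.range T, (M ^ t) i j := by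
  simp [cesaroPow, Matrix.sum_apply]

lemma cesaroPow_mem_Icc (hM : M ∈ Matrix.rowStochastic ℝ S) (T : ℕ) (i j : S) :
    cesaroPow M T i j ∈ Set.Icc (0 : ℝ) 1 := by
  have h t := Matrix.mem_Icc_of_mem_rowStochastic (pow_mem hM t) i j
  rw [cesaroPow_apply]
  refine ⟨mul_nonneg (by positivity) (Finset.sum_nonneg fun t _ => (h t).1), ?_⟩
  rcases Nat.eq_zero_or_pos T with rfl | hT
  · simp
  · have h' : ∑ t ∈ Finset.range T, (M ^ t) i j ≤ T := by
      simpa using Finset.sum_le_sum fun t (_ : t ∈ Finset.range T) => (h t).2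
    rw [one_div_mul_eq_div]
    exact div_le_one_of_le₀ h' (Nat.cast_nonneg T)

lemma cesaroPow_mul_comm (T : ℕ) : cesaroPow M T * M = M * cesaroPow M T := by
  simp [cesaroPow, Finset.sum_mul, Finset.mul_sum, ← pow_succ, ← pow_succ']

lemma cesaroPow_mul_sub (T : ℕ) :
    cesaroPow M T * M - cesaroPow M T = (1 / (T : ℝ)) • (M ^ T - 1) := by
  rw [cesaroPow, smul_mul_assoc, ← smul_sub, ← geom_sum_mul, mul_sub, mul_one]

lemma tendsto_cesaroPow_mul_sub (hM : M ∈ Matrix.rowStochastic ℝ S) :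
    Tendsto (fun T => cesaroPow M T * M - cesaroPow M T) atTop (𝓝 0) := by
  refine tendsto_pi_nhds.2 fun i => tendsto_pi_nhds.2 fun j => ?_
  have h0 : Tendsto (fun T : ℕ => 2 * (1 / (T : ℝ))) atTop (𝓝 0) := by
    simpa using tendsto_one_div_atTop_nhds_zero_nat.const_mul (2 : ℝ)
  refine squeeze_zero_norm (fun T => ?_) h0
  have h1 := Matrix.mem_Icc_of_mem_rowStochastic (pow_mem hM T) i j
  have h2 := Matrix.mem_Icc_of_mem_rowStochastic (one_mem (Matrix.rowStochastic ℝ S)) i j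
  rw [cesaroPow_mul_sub, Matrix.smul_apply, Matrix.sub_apply, smul_eq_mul, norm_mul, mul_comm,
    Real.norm_of_nonneg (by positivity : 0 ≤ 1 / (T : ℝ))]
  refine mul_le_mul_of_nonneg_right ?_ (by positivity)
  rw [Real.norm_eq_abs, abs_le]
  exact ⟨by linarith [h1.1, h2.2], by linarith [h1.2, h2.1]⟩

lemma mul_eq_of_tendsto_cesaroPow (hM : M ∈ Matrix.rowStochastic ℝ S) {l : Filter ℕ} [l.NeBot]
    (hl : l ≤ atTop) {L : Matrix S S ℝ} (hL : Tendsto (cesaroPow M) l (𝓝 L)) : L * M = L := by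
  have h1 : Tendsto (fun T => cesaroPow M T * M - cesaroPow M T) l (𝓝 (L * M - L)) :=
    (hL.mul_const M).sub hL
  exact sub_eq_zero.1 (tendsto_nhds_unique h1 ((tendsto_cesaroPow_mul_sub hM).mono_left hl))

lemma eq_mul_of_tendsto_cesaroPow (hM : M ∈ Matrix.rowStochastic ℝ S) {l : Filter ℕ} [l.NeBot]
    (hl : l ≤ atTop) {L : Matrix S S ℝ} (hL : Tendsto (cesaroPow M) l (𝓝 L)) : M * L = L := by
  have h : Tendsto (fun T => cesaroPow M T * M) l (𝓝 (M * L)) :=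
    (hL.const_mul M).congr fun T => (cesaroPow_mul_comm T).symm
  exact (tendsto_nhds_unique h (hL.mul_const M)).trans (mul_eq_of_tendsto_cesaroPow hM hl hL)

/-- A left multiple `L` that absorbs `M` absorbs the nontrivial Cesàro averages of `M`. -/
lemma mul_cesaroPow_of_mul_eq {L : Matrix S S ℝ} (hL : L * M = L) {T : ℕ} (hT : T ≠ 0) :
    L * cesaroPow M T = L := by
  have h t : L * M ^ t = L := by
    induction t with
    | zero => simp
    | succ n ih => rw [pow_succ, ← mul_assoc, ih, hL]
  have hT' : (T : ℝ) ≠ 0 := Nat.cast_ne_zero.2 hT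
  simp [cesaroPow, Finset.mul_sum, h, ← Nat.cast_smul_eq_nsmul ℝ, hT', smul_smul]

lemma cesaroPow_mul_of_mul_eq {L : Matrix S S ℝ} (hL : M * L = L) {T : ℕ} (hT : T ≠ 0) :
    cesaroPow M T * L = L := by
  have h t : M ^ t * L = L := by
    induction t with
    | zero => simp
    | succ n ih => rw [pow_succ, mul_assoc, hL, ih]
  have hT' : (T : ℝ) ≠ 0 := Nat.cast_ne_zero.2 hT
  simp [cesaroPow, Finset.sum_mul, h, ← Nat.cast_smul_eq_nsmul ℝ, hT', smul_smul]

/-- **Mean ergodic theorem for stochastic matrices.** -/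
theorem exists_tendsto_cesaroPow (hM : M ∈ Matrix.rowStochastic ℝ S) :
    ∃ L, Tendsto (cesaroPow M) atTop (𝓝 L) := by
  set K : Set (Matrix S S ℝ) := Set.univ.pi fun _ => Set.univ.pi fun _ => Set.Icc (0 : ℝ) 1
  have hK : IsCompact K := isCompact_univ_pi fun _ => isCompact_univ_pi fun _ => isCompact_Icc
  have hmem T : cesaroPow M T ∈ K := fun i _ j _ => cesaroPow_mem_Icc hM T i j
  obtain ⟨L, -, hL⟩ := hK.exists_mapClusterPt (f := atTop) (u := cesaroPow M)
    (tendsto_principal.2 (Eventually.of_forall hmem))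
  refine ⟨L, hK.tendsto_nhds_of_unique_mapClusterPt (Eventually.of_forall hmem) ?_⟩
  intro L' _ hL'
  obtain ⟨U, hU, hUL⟩ := mapClusterPt_iff_ultrafilter.1 hL
  obtain ⟨U', hU', hUL'⟩ := mapClusterPt_iff_ultrafilter.1 hL'
  have hne : ∀ᶠ T : ℕ in atTop, T ≠ 0 := eventually_ne_atTop 0
  have h1 : L * L' = L := tendsto_nhds_unique (hUL'.const_mul L) <|
    tendsto_const_nhds.congr' <| (hne.filter_mono hU').mono fun T hT =>
      (mul_cesaroPow_of_mul_eq (mul_eq_of_tendsto_cesaroPow hM hU hUL) hT).symm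
  have h2 : L * L' = L' := tendsto_nhds_unique (hUL.mul_const L') <|
    tendsto_const_nhds.congr' <| (hne.filter_mono hU).mono fun T hT =>
      (cesaroPow_mul_of_mul_eq (eq_mul_of_tendsto_cesaroPow hM hU' hUL') hT).symm
  exact h2.symm.trans h1

/-- Powers of a stochastic matrix preserve excessive functions. -/
lemma pow_mulVec_le (hM : M ∈ Matrix.rowStochastic ℝ S) {w : S → ℝ} (hw : M.mulVec w ≤ w)
    (t : ℕ) : (M ^ t).mulVec w ≤ w := by
  induction t with
  | zero => simp
  | succ n ih =>
    rw [pow_succ, ← Matrix.mulVec_mulVec]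
    refine le_trans (fun i => ?_) ih
    exact Finset.sum_le_sum fun j _ => mul_le_mul_of_nonneg_left (hw j)
      (Matrix.nonneg_of_mem_rowStochastic (pow_mem hM n))

/-- The limit of the Cesàro averages preserves excessive functions. -/
lemma mulVec_le_of_tendsto_cesaroPow (hM : M ∈ Matrix.rowStochastic ℝ S) {L : Matrix S S ℝ}
    (hL : Tendsto (cesaroPow M) atTop (𝓝 L)) {w : S → ℝ} (hw : M.mulVec w ≤ w) :
    L.mulVec w ≤ w := by
  have hlim : Tendsto (fun T => (cesaroPow M T).mulVec w) atTop (𝓝 (L.mulVec w)) :=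
    ((continuous_id.matrix_mulVec continuous_const).tendsto L).comp hL
  refine le_of_tendsto hlim ((eventually_ne_atTop 0).mono fun T hT => ?_)
  have hT' : (T : ℝ) ≠ 0 := Nat.cast_ne_zero.2 hT
  intro i
  have h : ∑ t ∈ Finset.range T, ((M ^ t).mulVec w) i ≤ T * w i := by
    simpa using Finset.sum_le_sum fun t (_ : t ∈ Finset.range T) => pow_mulVec_le hM hw t i
  rw [cesaroPow, Matrix.smul_mulVec, Matrix.sum_mulVec, Pi.smul_apply, Finset.sum_apply,
    smul_eq_mul, one_div_mul_eq_div, div_le_iff₀ (by positivity), mul_comm]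
  exact h

end Cesaro

section Discounted

variable {S A : Type*} [Fintype S] {P : S → A → S → ℝ}

lemma IsKernel.abs_sum_mul_le (hP : IsKernel P) (s : S) (a : A) (w : S → ℝ) :
    |∑ s', P s a s' * w s'| ≤ ‖w‖ := by
  calc |∑ s', P s a s' * w s'| ≤ ∑ s', |P s a s' * w s'| := Finset.abs_sum_le_sum_abs _ _
    _ ≤ ∑ s', P s a s' * ‖w‖ := Finset.sum_le_sum fun s' _ => by
        rw [abs_mul, abs_of_nonneg (hP.1 s a s')]
        exact mul_le_mul_of_nonneg_left (norm_le_pi_norm w s') (hP.1 s a s')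
    _ = ‖w‖ := by rw [← Finset.sum_mul, hP.2, one_mul]

/-- The normalized discounted optimality equation, with a maximizing action in each state and
a bound that does not depend on the discount factor. -/
theorem exists_discounted_solution [Fintype A] [Nonempty A] (hP : IsKernel P) (r : S × A → ℝ)
    {β : ℝ} (h0 : 0 ≤ β) (h1 : β < 1) :
    ∃ (f : S → A) (w : S → ℝ), ‖w‖ ≤ ‖r‖ ∧
      (∀ s a, (1 - β) * r (s, a) + β * ∑ s', P s a s' * w s' ≤ w s) ∧
      ∀ s, (1 - β) * r (s, f s) + β * ∑ s', P s (f s) s' * w s' = w s := by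
  set G : (S → ℝ) → S → A → ℝ := fun w s a => (1 - β) * r (s, a) + β * ∑ s', P s a s' * w s'
    with hG
  set B : (S → ℝ) → S → ℝ := fun w s => Finset.univ.sup' Finset.univ_nonempty (G w s)
  have hle w s a : G w s a ≤ B w s := Finset.le_sup' (G w s) (Finset.mem_univ a)
  have hcmp w w' s : B w s - B w' s ≤ β * dist w w' := by
    rw [sub_le_iff_le_add]
    refine Finset.sup'_le _ _ fun a _ => ?_
    have h := le_trans (le_abs_self _) (hP.abs_sum_mul_le s a (w - w'))
    simp only [Pi.sub_apply, mul_sub, Finset.sum_sub_distrib] at h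
    have h' := mul_le_mul_of_nonneg_left h h0
    have := hle w' s a
    simp only [hG] at this ⊢
    rw [dist_eq_norm]
    linarith
  have hB' : ContractingWith ⟨β, h0⟩ B := by
    refine ⟨by exact_mod_cast h1, LipschitzWith.of_dist_le_mul fun w w' => ?_⟩
    refine (dist_pi_le_iff (mul_nonneg h0 dist_nonneg)).2 fun s => ?_
    rw [Real.dist_eq, abs_le]
    have h := hcmp w' w s
    rw [dist_comm] at h
    exact ⟨by simpa using by linarith, hcmp w w' s⟩
  obtain ⟨w, hw⟩ : ∃ w, B w = w := ⟨_, hB'.fixedPoint_isFixedPt⟩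
  have hmax s : ∃ a, B w s = G w s a := by
    obtain ⟨a, -, ha⟩ := Finset.exists_mem_eq_sup' Finset.univ_nonempty (G w s)
    exact ⟨a, ha⟩
  choose f hf using hmax
  rw [hw] at hf
  refine ⟨f, w, ?_, fun s a => (hle w s a).trans_eq (congrFun hw s), fun s => (hf s).symm⟩
  have hbound : ‖w‖ ≤ (1 - β) * ‖r‖ + β * ‖w‖ := by
    have h1' : 0 ≤ 1 - β := by linarith
    refine (pi_norm_le_iff_of_nonneg (by positivity)).2 fun s => ?_
    rw [hf s]
    refine (norm_add_le _ _).trans (add_le_add ?_ ?_)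
    · rw [norm_mul, Real.norm_of_nonneg h1']
      exact mul_le_mul_of_nonneg_left (norm_le_pi_norm r _) h1'
    · rw [norm_mul, Real.norm_of_nonneg h0]
      exact mul_le_mul_of_nonneg_left (hP.abs_sum_mul_le s _ w) h0
  nlinarith

/-- A stationary flow averages the one-step expectation of `w` to the average of `w`. -/
lemma sum_flow_mul [Fintype A] {q : S × A → ℝ}
    (hq : ∀ s, ∑ a, q (s, a) = ∑ p : S × A, P p.1 p.2 s * q p) (w : S → ℝ) :
    ∑ p : S × A, q p * ∑ s', P p.1 p.2 s' * w s' = ∑ p : S × A, q p * w p.1 := by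
  calc ∑ p : S × A, q p * ∑ s', P p.1 p.2 s' * w s'
      = ∑ s', (∑ p : S × A, P p.1 p.2 s' * q p) * w s' := by
        simp only [Finset.mul_sum, Finset.sum_mul]
        rw [Finset.sum_comm]
        exact Finset.sum_congr rfl fun _ _ => Finset.sum_congr rfl fun _ _ => by ring
    _ = ∑ p : S × A, q p * w p.1 := by
        simp only [← hq, Fintype.sum_prod_type, Finset.sum_mul]

/-- Vanishing-discount limit: a function `w`, excessive for every action and harmonic for the
deterministic policy `f`, that bounds the reward of every stationary flow, with equality for flows
supported on `f`. -/
theorem exists_vanishing_discount_limit [Fintype A] [Nonempty A] (hP : IsKernel P)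
    (r : S × A → ℝ) :
    ∃ (f : S → A) (w : S → ℝ),
      (∀ s a, ∑ s', P s a s' * w s' ≤ w s) ∧
      (∀ s, ∑ s', P s (f s) s' * w s' = w s) ∧
      (∀ q ∈ flowPolytope P, dotSA r q ≤ ∑ p : S × A, q p * w p.1) ∧
      ∀ q ∈ flowPolytope P, (∀ s a, a ≠ f s → q (s, a) = 0) →
        dotSA r q = ∑ p : S × A, q p * w p.1 := by
  set β : ℕ → ℝ := fun n => 1 - 1 / ((n : ℝ) + 1) with hβ
  have hpos (n : ℕ) : 0 < 1 / ((n : ℝ) + 1) := by positivity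
  have hβ0 n : 0 ≤ β n := by
    simp only [hβ]
    rw [sub_nonneg, div_le_one n.cast_add_one_pos]
    linarith [n.cast_nonneg (α := ℝ)]
  have hβ1 n : β n < 1 := by linarith [hpos n]
  choose F W hWnorm hWle hWeq using fun n => exists_discounted_solution hP r (hβ0 n) (hβ1 n)
  set U : Ultrafilter ℕ := Filter.hyperfilter ℕ
  have hU : (U : Filter ℕ) ≤ atTop := Nat.hyperfilter_le_atTop
  have hβlim : Tendsto β U (𝓝 1) := by
    have h := (tendsto_one_div_add_atTop_nhds_zero_nat.const_sub (1 : ℝ)).mono_left hU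
    rwa [sub_zero] at h
  obtain ⟨f, hf⟩ := (U.map F).eq_pure_of_finite
  have hf' : ∀ᶠ n in (U : Filter ℕ), F n = f := by
    have : {f} ∈ U.map F := by rw [hf]; exact Ultrafilter.mem_pure.2 rfl
    exact this
  obtain ⟨w, -, hw⟩ := (isCompact_closedBall (0 : S → ℝ) ‖r‖).ultrafilter_le_nhds (U.map W)
    (tendsto_principal.2 (Eventually.of_forall fun n => mem_closedBall_zero_iff.2 (hWnorm n)))
  have hw : Tendsto W U (𝓝 w) := hw
  have hws s : Tendsto (fun n => W n s) U (𝓝 (w s)) := tendsto_pi_nhds.1 hw s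
  have hstep s a : Tendsto
      (fun n => (1 - β n) * r (s, a) + β n * ∑ s', P s a s' * W n s') U
      (𝓝 (∑ s', P s a s' * w s')) := by
    have h := ((hβlim.const_sub 1).mul_const (r (s, a))).add
      (hβlim.mul (tendsto_finsetSum Finset.univ fun s' _ => (hws s').const_mul (P s a s')))
    simpa using h
  have hqlim (q : S × A → ℝ) :
      Tendsto (fun n => ∑ p : S × A, q p * W n p.1) U (𝓝 (∑ p : S × A, q p * w p.1)) :=
    tendsto_finsetSum _ fun p _ => (hws p.1).const_mul (q p)
  have hsum (q : S × A → ℝ) (hq : q ∈ flowPolytope P) n :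
      ∑ p : S × A, q p *
        ((1 - β n) * r p + β n * (∑ s', P p.1 p.2 s' * W n s') - W n p.1) =
      (1 - β n) * (dotSA r q - ∑ p : S × A, q p * W n p.1) := by
    have h := sum_flow_mul hq.2.2 (W n)
    calc _ = (1 - β n) * dotSA r q + β n * (∑ p : S × A, q p * ∑ s', P p.1 p.2 s' * W n s')
          - ∑ p : S × A, q p * W n p.1 := by
          rw [dotSA, Finset.mul_sum, Finset.mul_sum, ← Finset.sum_add_distrib,
            ← Finset.sum_sub_distrib]
          exact Finset.sum_congr rfl fun _ _ => by ring
      _ = _ := by rw [h]; ring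
  refine ⟨f, w, fun s a => ?_, fun s => ?_, fun q hq => ?_, fun q hq hqf => ?_⟩
  · exact le_of_tendsto_of_tendsto' (hstep s a) (hws s) fun n => hWle n s a
  · refine tendsto_nhds_unique (hstep s (f s)) ((hws s).congr' ?_)
    filter_upwards [hf'] with n hn
    rw [← hn, hWeq]
  · refine ge_of_tendsto' (hqlim q) fun n => ?_
    have h : ∑ p : S × A, q p *
        ((1 - β n) * r p + β n * (∑ s', P p.1 p.2 s' * W n s') - W n p.1) ≤ 0 :=
      Finset.sum_nonpos fun p _ =>
        mul_nonpos_of_nonneg_of_nonpos (hq.1 p) (sub_nonpos.2 (hWle n p.1 p.2))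
    rw [hsum q hq] at h
    nlinarith [hβ1 n]
  · refine tendsto_nhds_unique (tendsto_const_nhds.congr' ?_) (hqlim q)
    filter_upwards [hf'] with n hn
    have h : ∑ p : S × A, q p *
        ((1 - β n) * r p + β n * (∑ s', P p.1 p.2 s' * W n s') - W n p.1) = 0 := by
      refine Finset.sum_eq_zero fun ⟨s, a⟩ _ => ?_
      by_cases ha : a = f s
      · rw [ha, ← hn, hWeq, sub_self, mul_zero]
      · rw [hqf s a ha, zero_mul]
    rw [hsum q hq] at h
    have := (mul_eq_zero.1 h).resolve_left (by linarith [hβ1 n])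
    linarith

end Discounted

/-- The deterministic policy that plays `f s` in state `s`. -/
def deterministicPolicy {S A : Type*} [DecidableEq A] (f : S → A) : S → A → ℝ :=
  fun s a => if a = f s then 1 else 0

lemma isPolicy_deterministicPolicy {S A : Type*} [Fintype A] [DecidableEq A] (f : S → A) :
    IsPolicy (deterministicPolicy f) := by
  refine ⟨fun s a => ?_, fun s => ?_⟩
  · unfold deterministicPolicy; split_ifs <;> norm_num
  · simp [deterministicPolicy]

section Occupation

variable {S A : Type*} [Fintype S] [Fintype A] {P : S → A → S → ℝ} {π : S → A → ℝ}

lemma markovMatrix_mulVec (w : S → ℝ) (s : S) :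
    (markovMatrix P π).mulVec w s = ∑ a, π s a * ∑ s', P s a s' * w s' := by
  simp only [Matrix.mulVec, dotProduct, markovMatrix, Finset.sum_mul, Finset.mul_sum, mul_assoc]
  exact Finset.sum_comm

lemma sum_mul_policy_mul (hπ : IsPolicy π) (x w : S → ℝ) :
    ∑ p : S × A, x p.1 * π p.1 p.2 * w p.1 = ∑ s, x s * w s := by
  rw [Fintype.sum_prod_type]
  refine Finset.sum_congr rfl fun s _ => ?_
  simp only [← Finset.sum_mul, ← Finset.mul_sum, hπ.2, mul_one]

variable [DecidableEq S] {L : Matrix S S ℝ}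

lemma markovMatrix_mem_rowStochastic (hP : IsKernel P) (hπ : IsPolicy π) :
    markovMatrix P π ∈ Matrix.rowStochastic ℝ S := by
  refine Matrix.mem_rowStochastic_iff_sum.2 ⟨fun s s' => ?_, fun s => ?_⟩
  · exact Finset.sum_nonneg fun a _ => mul_nonneg (hπ.1 s a) (hP.1 s a s')
  · simp only [markovMatrix]
    rw [Finset.sum_comm]
    simp [← Finset.mul_sum, hP.2, hπ.2]

/-- The occupation measure is the limiting state frequency times the policy. -/
lemma isOccupation_of_tendsto_cesaroPow (hL : Tendsto (cesaroPow (markovMatrix P π)) atTop (𝓝 L))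
    (s₁ : S) : IsOccupation P π s₁ fun p => L s₁ p.1 * π p.1 p.2 := by
  intro s a
  have h := (tendsto_pi_nhds.1 (tendsto_pi_nhds.1 hL s₁) s).mul_const (π s a)
  refine h.congr fun T => ?_
  rw [cesaroPow_apply, ← Finset.sum_mul, mul_assoc]

lemma IsOccupation.unique {s₁ : S} {q q' : S × A → ℝ} (h : IsOccupation P π s₁ q)
    (h' : IsOccupation P π s₁ q') : q = q' :=
  funext fun p => tendsto_nhds_unique (h p.1 p.2) (h' p.1 p.2)

lemma mem_flowPolytope_of_tendsto_cesaroPow (hP : IsKernel P) (hπ : IsPolicy π)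
    (hL : Tendsto (cesaroPow (markovMatrix P π)) atTop (𝓝 L)) (s₁ : S) :
    (fun p : S × A => L s₁ p.1 * π p.1 p.2) ∈ flowPolytope P := by
  have hM := markovMatrix_mem_rowStochastic hP hπ
  have hLe s : Tendsto (fun T => cesaroPow (markovMatrix P π) T s₁ s) atTop (𝓝 (L s₁ s)) :=
    tendsto_pi_nhds.1 (tendsto_pi_nhds.1 hL s₁) s
  refine ⟨fun p => mul_nonneg ?_ (hπ.1 _ _), ?_, fun s => ?_⟩
  · exact ge_of_tendsto' (hLe p.1) fun T => (cesaroPow_mem_Icc hM T s₁ p.1).1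
  · have h1 := mulVec_le_of_tendsto_cesaroPow hM hL (w := 1)
      (Matrix.one_vecMul_of_mem_rowStochastic hM).le s₁
    have h2 := mulVec_le_of_tendsto_cesaroPow hM hL (w := -1)
      (by rw [Matrix.mulVec_neg, Matrix.one_vecMul_of_mem_rowStochastic hM]) s₁
    have h3 := sum_mul_policy_mul hπ (L s₁) 1
    simp only [Pi.one_apply, mul_one] at h3
    rw [h3]
    simp only [Matrix.mulVec, dotProduct, Pi.neg_apply, Pi.one_apply, mul_neg, mul_one,
      Finset.sum_neg_distrib] at h1 h2
    linarith
  · have h := congrFun (congrFun (mul_eq_of_tendsto_cesaroPow hM le_rfl hL) s₁) s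
    dsimp only
    rw [← Finset.mul_sum, hπ.2, mul_one, ← h, Matrix.mul_apply, Fintype.sum_prod_type]
    simp only [markovMatrix, Finset.mul_sum]
    exact Finset.sum_congr rfl fun _ _ => Finset.sum_congr rfl fun _ _ => by ring

end Occupation

/-- **Existence of a deterministic stationary policy achieving the optimal average reward.**
There is a deterministic stationary policy whose occupation measure from `s₁` exists and
attains `sup { r·q : q ∈ Q(s₁) }`. -/
theorem deterministic_policy_attains_sup
    {S A : Type*} [Fintype S] [DecidableEq S] [Fintype A] [Nonempty S] [Nonempty A]
    (P : S → A → S → ℝ) (hP : IsKernel P) (s₁ : S) (r : S × A → ℝ) :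
    ∃ π : S → A → ℝ, IsPolicy π ∧ (∀ s a, π s a = 0 ∨ π s a = 1) ∧
      ∃ qstar : S × A → ℝ, IsOccupation P π s₁ qstar ∧
        dotSA r qstar = sSup {x | ∃ q ∈ occSet P s₁, x = dotSA r q} := by
  classical
  obtain ⟨f, w, hexc, hharm, hle, heq⟩ := exists_vanishing_discount_limit hP r
  have hπ := isPolicy_deterministicPolicy f
  have hM := markovMatrix_mem_rowStochastic hP hπ
  obtain ⟨L, hL⟩ := exists_tendsto_cesaroPow hM
  refine ⟨deterministicPolicy f, hπ, fun s a => ?_, _, isOccupation_of_tendsto_cesaroPow hL s₁, ?_⟩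
  · by_cases h : a = f s <;> simp [deterministicPolicy, h]
  have hMw : (markovMatrix P (deterministicPolicy f)).mulVec w = w := by
    funext s
    simp [markovMatrix_mulVec, deterministicPolicy, hharm]
  have hstar : w s₁ ≤ dotSA r fun p => L s₁ p.1 * deterministicPolicy f p.1 p.2 := by
    have h := mulVec_le_of_tendsto_cesaroPow hM hL (w := -w) (by rw [Matrix.mulVec_neg, hMw]) s₁
    rw [heq _ (mem_flowPolytope_of_tendsto_cesaroPow hP hπ hL s₁) fun s a ha => by
      simp [deterministicPolicy, ha], sum_mul_policy_mul hπ]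
    rw [Matrix.mulVec_neg] at h
    exact neg_le_neg_iff.1 h
  refine (IsGreatest.csSup_eq ⟨?_, ?_⟩).symm
  · exact ⟨_, ⟨_, hπ, isOccupation_of_tendsto_cesaroPow hL s₁⟩, rfl⟩
  rintro _ ⟨q, ⟨π', hπ', hq⟩, rfl⟩
  have hM' := markovMatrix_mem_rowStochastic hP hπ'
  obtain ⟨L', hL'⟩ := exists_tendsto_cesaroPow hM'
  rw [hq.unique (isOccupation_of_tendsto_cesaroPow hL' s₁)]
  refine (hle _ (mem_flowPolytope_of_tendsto_cesaroPow hP hπ' hL' s₁)).trans (le_trans ?_ hstar)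
  rw [sum_mul_policy_mul hπ']
  refine mulVec_le_of_tendsto_cesaroPow hM' hL' (fun s => ?_) s₁
  rw [markovMatrix_mulVec]
  calc ∑ a, π' s a * ∑ s', P s a s' * w s' ≤ ∑ a, π' s a * w s :=
        Finset.sum_le_sum fun a _ => mul_le_mul_of_nonneg_left (hexc s a) (hπ'.1 s a)
    _ = w s := by rw [← Finset.sum_mul, hπ'.2, one_mul]
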